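/- The switched system ẋ = f(t,x,u,σ) is iISS w.r.t. S with iISS gain χ if and only if it is forward complete w.r.t. S and, writing ‖u‖ = ∫_0^∞ χ(|u(τ)|) dτ, the following three conditions hold: (i) for every T > 0, r > 0 and s > 0 there exists C > 0 such that every x ∈ T(t₀,u,σ) with t₀ ≥ 0, u ∈ U_m, σ ∈ S, ‖u‖ ≤ s and |x(t₀)| ≤ r satisfies |x(t)| ≤ C for all t ∈ [t₀, t₀+T]; (ii) for each ε > 0 there exists δ > 0 such that every x ∈ T(t₀,u,σ) with ‖u‖ ≤ δ and |x(t₀)| ≤ δ satisfies |x(t)| ≤ ε for all t ≥ t₀; (iii) there exists ν ∈ K such that for any r ≥ ε > 0 there is T > 0 so that every x ∈ T(t₀,u,σ) with |x(t₀)| ≤ r satisfies |x(t)| ≤ ε + ν(‖u‖) for all t ≥ t₀ + T. -/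

import Mathlib

open MeasureTheory Set Filter Topology

noncomputable section

/-- A class-`K` function: continuous and strictly increasing on `[0,∞)` with `φ 0 = 0`. -/
def ClassK (φ : ℝ → ℝ) : Prop :=
  ContinuousOn φ (Set.Ici 0) ∧ StrictMonoOn φ (Set.Ici 0) ∧ φ 0 = 0

/-- A class-`K∞` function: class `K` and unbounded. -/
def ClassKInf (φ : ℝ → ℝ) : Prop :=
  ClassK φ ∧ Filter.Tendsto φ Filter.atTop Filter.atTop

/-- A class-`KL` function: `β (·, t)` is of class `K∞` for each `t ≥ 0` and `β (r, ·)`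
decreases monotonically to `0` for each fixed `r ≥ 0`. -/
def ClassKL (β : ℝ → ℝ → ℝ) : Prop :=
  (∀ t, 0 ≤ t → ClassKInf fun r => β r t) ∧
  (∀ r, 0 ≤ r → AntitoneOn (fun t => β r t) (Set.Ici 0) ∧
    Filter.Tendsto (fun t => β r t) Filter.atTop (nhds 0))

/-- A continuous positive definite function on `[0,∞)`. -/
def PosDefFun (φ : ℝ → ℝ) : Prop :=
  ContinuousOn φ (Set.Ici 0) ∧ φ 0 = 0 ∧ ∀ s, 0 < s → 0 < φ s

variable {Γ : Type*} {E : Type*} {F : Type*} {P : Type*}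
  [NormedAddCommGroup E] [NormedSpace ℝ E]
  [NormedAddCommGroup F] [NormedSpace ℝ F]
  [NormedAddCommGroup P]
  [MeasurableSpace E] [MeasurableSpace F] [MeasurableSpace P]

/-- A switching signal: piecewise constant with finitely many discontinuities on every
bounded interval of `[0,∞)`, and right-continuous. -/
def IsSwitchingSignal (σ : ℝ → Γ) : Prop :=
  ∀ b : ℝ, 0 < b → ∃ (n : ℕ) (t : ℕ → ℝ), t 0 = 0 ∧ (∀ i < n, t i < t (i + 1)) ∧ b ≤ t n ∧
    ∀ i < n, ∀ s ∈ Set.Ico (t i) (t (i + 1)), σ s = σ (t i)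

/-- An admissible input: Lebesgue measurable and locally essentially bounded. -/
def IsInput (u : ℝ → F) : Prop :=
  Measurable u ∧ ∀ b : ℝ, ∃ C : ℝ, ∀ᵐ s ∂volume, s ∈ Set.Icc (0 : ℝ) b → ‖u s‖ ≤ C

/-- A Carathéodory solution of `ẋ = f t x u σ` on the domain `D ⊆ [0,∞)` (an interval):
a continuous function satisfying the corresponding integral equation. -/
structure IsSolution (f : ℝ → E → F → Γ → E) (u : ℝ → F) (σ : ℝ → Γ)
    (D : Set ℝ) (x : ℝ → E) : Prop where
  ordConnected : D.OrdConnected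
  subset_Ici : D ⊆ Set.Ici 0
  nonempty : D.Nonempty
  continuousOn : ContinuousOn x D
  intervalIntegrable : ∀ a ∈ D, ∀ b ∈ D,
    IntervalIntegrable (fun s => f s (x s) (u s) (σ s)) volume a b
  integral_eq : ∀ a ∈ D, ∀ b ∈ D, x b = x a + ∫ s in a..b, f s (x s) (u s) (σ s)

/-- A maximally defined Carathéodory solution: one admitting no proper extension. -/
def IsMaximalSolution (f : ℝ → E → F → Γ → E) (u : ℝ → F) (σ : ℝ → Γ)
    (D : Set ℝ) (x : ℝ → E) : Prop :=
  IsSolution f u σ D x ∧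
    ∀ D' : Set ℝ, ∀ x' : ℝ → E, IsSolution f u σ D' x' → D ⊆ D' → Set.EqOn x x' D → D' ⊆ D

/-- Standing regularity assumptions on `f`: vanishing at the origin for zero input,
Lebesgue measurable in `t`, continuous in `(ξ, μ)`. -/
def Regular (f : ℝ → E → F → Γ → E) : Prop :=
  (∀ t, 0 ≤ t → ∀ i, f t 0 0 i = 0) ∧
  (∀ ξ μ i, Measurable fun t => f t ξ μ i) ∧
  (∀ t i, Continuous fun q : E × F => f t q.1 q.2 i)

/-- Forward completeness w.r.t. `S`. -/
def ForwardComplete (f : ℝ → E → F → Γ → E) (S : Set (ℝ → Γ)) : Prop :=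
  ∀ t₀, 0 ≤ t₀ → ∀ u : ℝ → F, IsInput u → ∀ σ ∈ S, ∀ D x,
    IsMaximalSolution f u σ D x → t₀ ∈ D → Set.Ici t₀ ⊆ D

/-- iISS w.r.t. `S` with iISS gain `χ`. -/
def IISS (f : ℝ → E → F → Γ → E) (S : Set (ℝ → Γ)) (χ : ℝ → ℝ) : Prop :=
  ForwardComplete f S ∧
  ∃ β ρ, ClassKL β ∧ ClassK ρ ∧
    ∀ t₀, 0 ≤ t₀ → ∀ u : ℝ → F, IsInput u → ∀ σ ∈ S, ∀ D x,
      IsMaximalSolution f u σ D x → t₀ ∈ D → ∀ t ∈ D, t₀ ≤ t →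
        ‖x t‖ ≤ β ‖x t₀‖ (t - t₀) + ρ (∫ s in t₀..t, χ ‖u s‖)

/-- 0-GUAS w.r.t. `S`. -/
def ZeroGUAS (f : ℝ → E → F → Γ → E) (S : Set (ℝ → Γ)) : Prop :=
  ∃ β, ClassKL β ∧
    ∀ t₀, 0 ≤ t₀ → ∀ σ ∈ S, ∀ D x,
      IsMaximalSolution f (fun _ => (0 : F)) σ D x → t₀ ∈ D → ∀ t ∈ D, t₀ ≤ t →
        ‖x t‖ ≤ β ‖x t₀‖ (t - t₀)

/-- UBEBS w.r.t. `S` with UBEBS gain `α`. -/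
def UBEBS (f : ℝ → E → F → Γ → E) (S : Set (ℝ → Γ)) (α : ℝ → ℝ) : Prop :=
  ∃ α₁ α₂ c, ClassK α₁ ∧ ClassK α₂ ∧ 0 ≤ c ∧
    ∀ t₀, 0 ≤ t₀ → ∀ u : ℝ → F, IsInput u → ∀ σ ∈ S, ∀ D x,
      IsMaximalSolution f u σ D x → t₀ ∈ D → ∀ t ∈ D, t₀ ≤ t →
        ‖x t‖ ≤ α₁ ‖x t₀‖ + α₂ (∫ s in t₀..t, α ‖u s‖) + c

/-- The total `χ`-energy `∫_0^∞ χ(|u(s)|) ds` of an input, as an extended nonnegative real. -/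
def Energy (χ : ℝ → ℝ) (u : ℝ → F) : ENNReal :=
  ∫⁻ s in Set.Ioi (0 : ℝ), ENNReal.ofReal (χ ‖u s‖)

/-- `χ`-BEICS w.r.t. `S`: every solution corresponding to an input of finite `χ`-energy
is defined for all future times and converges to `0`. -/
def BEICS (f : ℝ → E → F → Γ → E) (S : Set (ℝ → Γ)) (χ : ℝ → ℝ) : Prop :=
  ∀ t₀, 0 ≤ t₀ → ∀ u : ℝ → F, IsInput u → ∀ σ ∈ S, ∀ D x,
    IsMaximalSolution f u σ D x → t₀ ∈ D → Energy χ u ≠ ⊤ →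
      Set.Ici t₀ ⊆ D ∧ Filter.Tendsto x Filter.atTop (nhds 0)

/-- Condition (C1) of Assumption A, with the class-`K` function `γ`. -/
def CondC1 (f : ℝ → E → F → Γ → E) (γ : ℝ → ℝ) : Prop :=
  ∃ N : ℝ → ℝ, (∀ r, 0 ≤ r → 0 < N r) ∧ MonotoneOn N (Set.Ici 0) ∧
    ∀ t, 0 ≤ t → ∀ (ξ : E) (μ : F) (i : Γ), ‖f t ξ μ i‖ ≤ N ‖ξ‖ * (1 + γ ‖μ‖)

/-- Condition (C2) of Assumption A. -/
def CondC2 (f : ℝ → E → F → Γ → E) : Prop :=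
  ∀ r, 0 < r → ∀ ε, 0 < ε → ∃ δ, 0 < δ ∧ ∀ t, 0 ≤ t → ∀ (i : Γ) (ξ : E) (μ : F),
    ‖ξ‖ ≤ r → ‖μ‖ ≤ δ → ‖f t ξ μ i - f t ξ 0 i‖ < ε

/-- Condition (C3) of Assumption A: `f (t, ξ, 0, i)` is locally Lipschitz in `ξ`
uniformly in `t` and `i`. -/
def CondC3 (f : ℝ → E → F → Γ → E) : Prop :=
  ∀ K : Set E, IsCompact K → ∃ L, 0 ≤ L ∧ ∀ t, 0 ≤ t → ∀ (i : Γ), ∀ ξ ∈ K, ∀ ξ' ∈ K,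
    ‖f t ξ 0 i - f t ξ' 0 i‖ ≤ L * ‖ξ - ξ'‖

/-- Assumption A, with `γ` the class-`K` function appearing in (C1). -/
def AssumptionA (f : ℝ → E → F → Γ → E) (γ : ℝ → ℝ) : Prop :=
  ClassK γ ∧ CondC1 f γ ∧ CondC2 f ∧ CondC3 f

/-- Sandwich bounds `φ₁(|ξ|) ≤ V(t,ξ) ≤ φ₂(|ξ|)` with `φ₁, φ₂` of class `K∞`. -/
def StorageBounds (V : ℝ → E → ℝ) : Prop :=
  ∃ φ₁ φ₂, ClassKInf φ₁ ∧ ClassKInf φ₂ ∧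
    ∀ t, 0 ≤ t → ∀ ξ : E, φ₁ ‖ξ‖ ≤ V t ξ ∧ V t ξ ≤ φ₂ ‖ξ‖

/-- 0-OD (zero-output dissipativity) w.r.t. `S` witnessed by the storage function `V`
and the supply function `α`. -/
def ZeroODWithStorage (f : ℝ → E → F → Γ → E) (S : Set (ℝ → Γ)) (V : ℝ → E → ℝ)
    (α : ℝ → ℝ) : Prop :=
  StorageBounds V ∧
    ∀ t₀, 0 ≤ t₀ → ∀ u : ℝ → F, IsInput u → ∀ σ ∈ S, ∀ D x,
      IsMaximalSolution f u σ D x → t₀ ∈ D → ∀ t ∈ D, t₀ ≤ t →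
        V t (x t) ≤ V t₀ (x t₀) + ∫ s in t₀..t, α ‖u s‖

/-- 0-OD w.r.t. `S` with supply function `α`. -/
def ZeroOD (f : ℝ → E → F → Γ → E) (S : Set (ℝ → Γ)) (α : ℝ → ℝ) : Prop :=
  ∃ V : ℝ → E → ℝ, (∀ t ξ, 0 ≤ V t ξ) ∧ ZeroODWithStorage f S V α

/-- `h`-OD (output dissipativity) w.r.t. `S` with supply function `α`. -/
def HOD (f : ℝ → E → F → Γ → E) (h : ℝ → E → F → Γ → P) (S : Set (ℝ → Γ))
    (α : ℝ → ℝ) : Prop :=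
  ∃ V : ℝ → E → ℝ, (∀ t ξ, 0 ≤ V t ξ) ∧ StorageBounds V ∧
    ∃ α₃, PosDefFun α₃ ∧
      ∀ t₀, 0 ≤ t₀ → ∀ u : ℝ → F, IsInput u → ∀ σ ∈ S, ∀ D x,
        IsMaximalSolution f u σ D x → t₀ ∈ D → ∀ t ∈ D, t₀ ≤ t →
          V t (x t) ≤ V t₀ (x t₀) - (∫ s in t₀..t, α₃ ‖h s (x s) (u s) (σ s)‖)
            + ∫ s in t₀..t, α ‖u s‖

/-- The pair `(h, f)` is zero-input output-persistently exciting w.r.t. `S`. -/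
def OutputPE (f : ℝ → E → F → Γ → E) (h : ℝ → E → F → Γ → P)
    (S : Set (ℝ → Γ)) : Prop :=
  ∀ ε : ℝ, 0 < ε → ε ≤ 1 → ∃ T, 0 < T ∧ ∃ r, 0 < r ∧
    ∀ t₀, 0 ≤ t₀ → ∀ σ ∈ S, ∀ D x,
      IsMaximalSolution f (fun _ => (0 : F)) σ D x → t₀ ∈ D →
        ∀ t, t₀ ≤ t → Set.Icc t (t + T) ⊆ D →
          (∀ τ ∈ Set.Icc t (t + T), ε ≤ ‖x τ‖ ∧ ‖x τ‖ ≤ 1 / ε) →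
            r ≤ ∫ τ in t..(t + T), ‖h τ (x τ) 0 (σ τ)‖ ^ 2

/-- Standing regularity assumptions on the output map `h`. -/
def OutputRegular (h : ℝ → E → F → Γ → P) : Prop :=
  (∀ ξ μ i, Measurable fun t => h t ξ μ i) ∧
  (∀ t i, Continuous fun q : E × F => h t q.1 q.2 i) ∧
  ∀ K : Set E, IsCompact K → (0 : E) ∉ K → ∃ M : ℝ,
    ∀ᵐ t ∂volume, 0 ≤ t → ∀ ξ ∈ K, ∀ i : Γ, ‖h t ξ 0 i‖ ≤ M

/-- The average of `s ↦ g s` over `[r, 2r]`, written as a dilation average. -/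
def dilationAverage (g : ℝ → ℝ) (r : ℝ) : ℝ := ∫ v in (1 : ℝ)..2, g (r * v)

lemma Monotone.intervalIntegrable_comp_mul {g : ℝ → ℝ} (hg : Monotone g) {r : ℝ} (hr : 0 ≤ r)
    (a b : ℝ) : IntervalIntegrable (fun v => g (r * v)) volume a b :=
  (hg.comp (monotone_id.const_mul hr)).intervalIntegrable

lemma le_dilationAverage {g : ℝ → ℝ} (hg : Monotone g) {r : ℝ} (hr : 0 ≤ r) :
    g r ≤ dilationAverage g r := by
  have h : (∫ _ in (1 : ℝ)..2, g r) ≤ ∫ v in (1 : ℝ)..2, g (r * v) :=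
    intervalIntegral.integral_mono_on one_le_two intervalIntegrable_const
      (hg.intervalIntegrable_comp_mul hr _ _)
      (fun v hv => hg (by nlinarith [hv.1]))
  rw [intervalIntegral.integral_const, smul_eq_mul] at h
  unfold dilationAverage
  linarith

lemma dilationAverage_le {g : ℝ → ℝ} (hg : Monotone g) {r : ℝ} (hr : 0 ≤ r) :
    dilationAverage g r ≤ g (r * 2) := by
  have h : (∫ v in (1 : ℝ)..2, g (r * v)) ≤ ∫ _ in (1 : ℝ)..2, g (r * 2) :=
    intervalIntegral.integral_mono_on one_le_two (hg.intervalIntegrable_comp_mul hr _ _)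
      intervalIntegrable_const (fun v hv => hg (by nlinarith [hv.2]))
  rw [intervalIntegral.integral_const, smul_eq_mul] at h
  unfold dilationAverage
  linarith

lemma dilationAverage_mono {g h : ℝ → ℝ} (hg : Monotone g) (hh : Monotone h)
    (hgh : ∀ s, g s ≤ h s) {r r' : ℝ} (hr : 0 ≤ r) (hrr' : r ≤ r') :
    dilationAverage g r ≤ dilationAverage h r' :=
  intervalIntegral.integral_mono_on one_le_two (hg.intervalIntegrable_comp_mul hr _ _)
    (hh.intervalIntegrable_comp_mul (hr.trans hrr') _ _)
    (fun v hv => (hgh _).trans (hh (by nlinarith [hv.1])))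

lemma dilationAverage_zero {g : ℝ → ℝ} (h0 : g 0 = 0) : dilationAverage g 0 = 0 := by
  simp [dilationAverage, h0]

lemma continuousOn_dilationAverage {g : ℝ → ℝ} (hg : Monotone g) (h0 : g 0 = 0)
    (hlim : ∀ ε > 0, ∃ δ > 0, g δ ≤ ε) : ContinuousOn (dilationAverage g) (Ici 0) := by
  intro r hr
  rcases (mem_Ici.1 hr).eq_or_lt with rfl | hr
  · rw [ContinuousWithinAt, dilationAverage_zero h0, Metric.tendsto_nhdsWithin_nhds]
    intro ε hε
    obtain ⟨δ, hδ, hgδ⟩ := hlim (ε / 2) (half_pos hε)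
    refine ⟨δ / 2, half_pos hδ, fun {s} hs hsδ => ?_⟩
    rw [Real.dist_0_eq_abs] at hsδ ⊢
    have hs0 : 0 ≤ s := hs
    rw [abs_of_nonneg hs0] at hsδ
    have h1 : 0 ≤ g s := h0 ▸ hg hs0
    have h2 := le_dilationAverage hg hs0
    have h3 := dilationAverage_le hg hs0
    have h4 : g (s * 2) ≤ g δ := hg (by linarith)
    rw [abs_of_nonneg (h1.trans h2)]
    linarith
  · have hint : ∀ a b, IntervalIntegrable g volume a b := fun _ _ => hg.intervalIntegrable
    have hc : Continuous fun b => ∫ s in (0 : ℝ)..b, g s :=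
      intervalIntegral.continuous_primitive hint 0
    have hev : dilationAverage g =ᶠ[𝓝 r]
        fun s => s⁻¹ * ((∫ v in (0 : ℝ)..(s * 2), g v) - ∫ v in (0 : ℝ)..(s * 1), g v) := by
      filter_upwards [lt_mem_nhds hr] with s hs
      rw [intervalIntegral.integral_interval_sub_left (hint _ _) (hint _ _), dilationAverage,
        intervalIntegral.integral_comp_mul_left _ hs.ne', smul_eq_mul]
    refine (ContinuousAt.congr ?_ hev.symm).continuousWithinAt
    refine (continuousAt_inv₀ hr.ne').mul (Continuous.continuousAt ?_)
    exact (hc.comp (by fun_prop)).sub (hc.comp (by fun_prop))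

/-- A monotone function vanishing at `0` continuously is dominated by a class-`K∞` function. -/
lemma classKInf_dilationAverage_add {g : ℝ → ℝ} (hg : Monotone g) (h0 : g 0 = 0)
    (hlim : ∀ ε > 0, ∃ δ > 0, g δ ≤ ε) {c : ℝ} (hc : 0 < c) :
    ClassKInf fun r => dilationAverage g r + c * r := by
  refine ⟨⟨(continuousOn_dilationAverage hg h0 hlim).add (by fun_prop), ?_, ?_⟩, ?_⟩
  · intro a ha b _ hab
    exact add_lt_add_of_le_of_lt (dilationAverage_mono hg hg (fun _ => le_rfl) ha hab.le)
      (mul_lt_mul_of_pos_left hab hc)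
  · simp [dilationAverage_zero h0]
  · refine tendsto_atTop_mono' _ ?_ (tendsto_id.const_mul_atTop hc)
    filter_upwards [eventually_ge_atTop 0] with r hr
    have h1 : 0 ≤ g r := h0 ▸ hg hr
    have h2 := le_dilationAverage hg hr
    simp only [id]
    linarith

lemma ClassK.nonneg {φ : ℝ → ℝ} (h : ClassK φ) {r : ℝ} (hr : 0 ≤ r) : 0 ≤ φ r :=
  h.2.2 ▸ h.2.1.monotoneOn self_mem_Ici hr hr

lemma ClassK.mono {φ : ℝ → ℝ} (h : ClassK φ) {r s : ℝ} (hr : 0 ≤ r) (hrs : r ≤ s) : φ r ≤ φ s :=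
  h.2.1.monotoneOn hr (hr.trans hrs) hrs

lemma ClassK.add {φ ψ : ℝ → ℝ} (h : ClassK φ) (h' : ClassK ψ) : ClassK fun r => φ r + ψ r :=
  ⟨h.1.add h'.1, fun _ ha _ hb hab => add_lt_add (h.2.1 ha hb hab) (h'.2.1 ha hb hab),
    by simp [h.2.2, h'.2.2]⟩

lemma ClassK.exists_pos_le {φ : ℝ → ℝ} (h : ClassK φ) {ε : ℝ} (hε : 0 < ε) :
    ∃ δ > 0, φ δ ≤ ε := by
  have ht : Tendsto φ (𝓝[>] 0) (𝓝 0) := by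
    simpa [ContinuousWithinAt, h.2.2] using
      (h.1 0 self_mem_Ici).mono_left (nhdsWithin_mono _ Ioi_subset_Ici_self)
  obtain ⟨δ, h1, h2⟩ := ((ht.eventually (gt_mem_nhds hε)).and self_mem_nhdsWithin).exists
  exact ⟨δ, h2, h1.le⟩

/-- A function that is monotone in its first argument, antitone in its second one, dominated by a
class-`K` function of the first one and vanishing as the second one tends to infinity is dominated
by a class-`KL` function. -/
lemma exists_classKL_ge {ψ : ℝ → ℝ → ℝ} {α : ℝ → ℝ} (hα : ClassK α)
    (hmono : ∀ t, Monotone fun r => ψ r t) (hanti : ∀ r, Antitone (ψ r))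
    (hnonneg : ∀ r t, 0 ≤ ψ r t) (hle : ∀ r t, 0 ≤ r → ψ r t ≤ α r)
    (hlim : ∀ r ε, 0 < ε → ∃ T, ψ r T ≤ ε) :
    ∃ β, ClassKL β ∧ ∀ r t, 0 ≤ r → 0 ≤ t → ψ r t ≤ β r t := by
  have h0 : ∀ t, ψ 0 t = 0 := fun t =>
    le_antisymm ((hle 0 t le_rfl).trans_eq hα.2.2) (hnonneg 0 t)
  refine ⟨fun r t => dilationAverage (fun s => ψ s t) r + (1 + t)⁻¹ * r,
    ⟨fun t ht => ?_, fun r hr => ⟨?_, ?_⟩⟩, fun r t hr ht => ?_⟩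
  · refine classKInf_dilationAverage_add (hmono t) (h0 t) (fun ε hε => ?_) (by positivity)
    obtain ⟨δ, hδ, h⟩ := hα.exists_pos_le hε
    exact ⟨δ, hδ, (hle δ t hδ.le).trans h⟩
  · intro a ha b _ hab
    have ha' : 0 ≤ a := ha
    have h1 := dilationAverage_mono (hmono b) (hmono a) (fun s => hanti s hab) hr le_rfl
    have h2 : (1 + b)⁻¹ ≤ (1 + a)⁻¹ := inv_anti₀ (by linarith) (by linarith)
    exact add_le_add h1 (mul_le_mul_of_nonneg_right h2 hr)
  · have h1 : Tendsto (ψ (r * 2)) atTop (𝓝 0) := by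
      rw [Metric.tendsto_atTop]
      intro ε hε
      obtain ⟨T, hT⟩ := hlim (r * 2) (ε / 2) (half_pos hε)
      refine ⟨T, fun t ht => ?_⟩
      rw [Real.dist_0_eq_abs, abs_of_nonneg (hnonneg _ _)]
      linarith [hanti (r * 2) ht]
    have h2 : Tendsto (fun t => dilationAverage (fun s => ψ s t) r) atTop (𝓝 0) :=
      squeeze_zero (fun t => (hnonneg r t).trans (le_dilationAverage (hmono t) hr))
        (fun t => dilationAverage_le (hmono t) hr) h1
    have h3 : Tendsto (fun t : ℝ => (1 + t)⁻¹) atTop (𝓝 0) :=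
      tendsto_inv_atTop_zero.comp (tendsto_atTop_add_const_left _ _ tendsto_id)
    simpa using h2.add (h3.mul_const r)
  · have h1 := le_dilationAverage (hmono t) hr
    have h2 : 0 ≤ (1 + t)⁻¹ * r := by positivity
    exact h1.trans (le_add_of_nonneg_right h2)

/-- Comparison-function core of the characterization. The relation `R a τ e y` reads: some
trajectory with initial norm `a` and input energy `e` has norm `y` after time `τ`. -/
lemma exists_classKL_add_classK {R : ℝ → ℝ → ℝ → ℝ → Prop}
    (hR : ∀ a τ e y, R a τ e y → 0 ≤ a ∧ 0 ≤ τ ∧ 0 ≤ e)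
    (hbdd : ∀ T, 0 < T → ∀ r, 0 < r → ∀ s, 0 < s → ∃ C,
      ∀ a τ e y, R a τ e y → a ≤ r → e ≤ s → τ ≤ T → y ≤ C)
    (hstab : ∀ ε, 0 < ε → ∃ δ, 0 < δ ∧ ∀ a τ e y, R a τ e y → a ≤ δ → e ≤ δ → y ≤ ε)
    {ν : ℝ → ℝ} (hν : ClassK ν)
    (hattr : ∀ r ε, 0 < ε → ε ≤ r → ∃ T, 0 < T ∧
      ∀ a τ e y, R a τ e y → a ≤ r → T ≤ τ → y ≤ ε + ν e) :
    ∃ β ρ, ClassKL β ∧ ClassK ρ ∧ ∀ a τ e y, R a τ e y → y ≤ β a τ + ρ e := by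
  set A : ℝ → Set ℝ := fun r => insert 0 {y | ∃ a τ e, R a τ e y ∧ a ≤ r ∧ e ≤ r}
  have hAmono : Monotone A := fun r r' h => insert_subset_insert
    (fun y ⟨a, τ, e, h1, h2, h3⟩ => ⟨a, τ, e, h1, h2.trans h, h3.trans h⟩)
  have hAbdd : ∀ r, BddAbove (A r) := by
    intro r
    obtain ⟨T, hT, hTy⟩ := hattr (max r 1) (max r 1) (by positivity) le_rfl
    obtain ⟨C, hC⟩ := hbdd T hT (max r 1) (by positivity) (max r 1) (by positivity)
    refine ⟨max 0 (max C (max r 1 + ν (max r 1))), ?_⟩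
    rintro y (rfl | ⟨a, τ, e, h, ha, he⟩)
    · exact le_max_left _ _
    · refine le_max_of_le_right ?_
      rcases le_total τ T with h' | h'
      · exact le_max_of_le_left
          (hC a τ e y h (ha.trans (le_max_left _ _)) (he.trans (le_max_left _ _)) h')
      · refine le_max_of_le_right ((hTy a τ e y h (ha.trans (le_max_left _ _)) h').trans ?_)
        have := hν.mono (hR _ _ _ _ h).2.2 (he.trans (le_max_left r 1))
        linarith
  set M : ℝ → ℝ := fun r => sSup (A r)
  have hMmono : Monotone M := fun r r' h =>
    csSup_le_csSup (hAbdd r') ⟨0, mem_insert _ _⟩ (hAmono h)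
  have hM_nonneg : ∀ r, 0 ≤ M r := fun r => le_csSup (hAbdd r) (mem_insert _ _)
  have hMlim : ∀ ε > 0, ∃ δ > 0, M δ ≤ ε := by
    intro ε hε
    obtain ⟨δ, hδ, h⟩ := hstab ε hε
    refine ⟨δ, hδ, csSup_le ⟨0, mem_insert _ _⟩ ?_⟩
    rintro y (rfl | ⟨a, τ, e, h1, h2, h3⟩)
    exacts [hε.le, h a τ e y h1 h2 h3]
  have hM0 : M 0 = 0 := by
    refine le_antisymm (le_of_forall_pos_le_add fun ε hε => ?_) (hM_nonneg 0)
    obtain ⟨δ, hδ, h⟩ := hMlim ε hε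
    linarith [hMmono hδ.le]
  set α : ℝ → ℝ := fun r => dilationAverage M r + 1 * r with hα_def
  have hα : ClassK α := (classKInf_dilationAverage_add hMmono hM0 hMlim one_pos).1
  have hαM : ∀ r, 0 ≤ r → M r ≤ α r := fun r hr => by
    have := le_dilationAverage hMmono hr
    simp only [hα_def]
    linarith
  have hyα : ∀ a τ e y, R a τ e y → y ≤ α a + α e := by
    intro a τ e y h
    obtain ⟨ha, -, he⟩ := hR _ _ _ _ h
    have h1 : y ≤ α (max a e) :=
      (le_csSup (hAbdd _) (Or.inr ⟨a, τ, e, h, le_max_left _ _, le_max_right _ _⟩)).trans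
        (hαM _ (ha.trans (le_max_left _ _)))
    have h2 := hα.nonneg ha
    have h3 := hα.nonneg he
    rcases max_cases a e with h' | h' <;> rw [h'.1] at h1 <;> linarith
  set B : ℝ → ℝ → Set ℝ := fun r t =>
    insert 0 {z | ∃ a τ e y, R a τ e y ∧ a ≤ r ∧ t ≤ τ ∧ z = y - (α e + ν e)}
  have hBle : ∀ r t, ∀ z ∈ B r t, z ≤ α (max r 0) := by
    rintro r t z (rfl | ⟨a, τ, e, y, h, ha, -, rfl⟩)
    · exact hα.nonneg (le_max_right _ _)
    · obtain ⟨ha0, -, he⟩ := hR _ _ _ _ h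
      linarith [hyα a τ e y h, hν.nonneg he, hα.mono ha0 (ha.trans (le_max_left r 0))]
  have hBbdd : ∀ r t, BddAbove (B r t) := fun r t => ⟨_, hBle r t⟩
  have hBne : ∀ r t, (B r t).Nonempty := fun r t => ⟨0, mem_insert _ _⟩
  obtain ⟨β, hβ, hψβ⟩ := exists_classKL_ge (ψ := fun r t => sSup (B r t)) hα
    (fun t r r' h => csSup_le_csSup (hBbdd _ _) (hBne _ _) (insert_subset_insert
      fun z ⟨a, τ, e, y, h1, h2, h3⟩ => ⟨a, τ, e, y, h1, h2.trans h, h3⟩))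
    (fun r t t' h => csSup_le_csSup (hBbdd _ _) (hBne _ _) (insert_subset_insert
      fun z ⟨a, τ, e, y, h1, h2, h3, h4⟩ => ⟨a, τ, e, y, h1, h2, h.trans h3, h4⟩))
    (fun r t => le_csSup (hBbdd _ _) (mem_insert _ _))
    (fun r t hr => csSup_le (hBne _ _) fun z hz => by
      simpa [max_eq_left hr] using hBle r t z hz)
    (fun r ε hε => by
      obtain ⟨T, -, hT⟩ := hattr (max r ε) ε hε (le_max_right _ _)
      refine ⟨T, csSup_le (hBne _ _) ?_⟩
      rintro z (rfl | ⟨a, τ, e, y, h, ha, hτ, rfl⟩)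
      · exact hε.le
      · linarith [hT a τ e y h (ha.trans (le_max_left _ _)) hτ, hα.nonneg (hR _ _ _ _ h).2.2])
  refine ⟨β, fun r => α r + ν r, hβ, hα.add hν, fun a τ e y h => ?_⟩
  obtain ⟨ha, hτ, -⟩ := hR _ _ _ _ h
  have h1 : y - (α e + ν e) ≤ sSup (B a τ) :=
    le_csSup (hBbdd _ _) (Or.inr ⟨a, τ, e, y, h, le_rfl, le_rfl, rfl⟩)
  linarith [hψβ a τ ha hτ]

/-- Being a solution on an interval `D` can be checked on the compact subintervals of `D`. -/
lemma IsSolution.of_forall_uIcc {f : ℝ → E → F → Γ → E} {u : ℝ → F} {σ : ℝ → Γ} {D : Set ℝ}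
    {x : ℝ → E} (hD : D.OrdConnected) (hD0 : D ⊆ Ici 0) (hne : D.Nonempty)
    (h : ∀ a ∈ D, ∀ b ∈ D, ∃ u' D' x', IsSolution f u' σ D' x' ∧ a ∈ D' ∧ b ∈ D' ∧
      EqOn x' x (uIcc a b) ∧ EqOn u' u (uIcc a b)) : IsSolution f u σ D x := by
  refine ⟨hD, hD0, hne, ?_, ?_, ?_⟩
  · intro p hp
    obtain ⟨a, ha, hap, ha'⟩ : ∃ a ∈ D, a ≤ p ∧ ∀ᶠ s in 𝓝[D] p, a ≤ s := by
      by_cases hl : ∃ a ∈ D, a < p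
      · obtain ⟨a, ha, hap⟩ := hl
        exact ⟨a, ha, hap.le,
          nhdsWithin_le_nhds ((lt_mem_nhds hap).mono fun s hs => le_of_lt hs)⟩
      · push Not at hl
        exact ⟨p, hp, le_rfl, eventually_nhdsWithin_of_forall hl⟩
    obtain ⟨b, hb, hpb, hb'⟩ : ∃ b ∈ D, p ≤ b ∧ ∀ᶠ s in 𝓝[D] p, s ≤ b := by
      by_cases hl : ∃ b ∈ D, p < b
      · obtain ⟨b, hb, hpb⟩ := hl
        exact ⟨b, hb, hpb.le,
          nhdsWithin_le_nhds ((gt_mem_nhds hpb).mono fun s hs => le_of_lt hs)⟩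
      · push Not at hl
        exact ⟨p, hp, le_rfl, eventually_nhdsWithin_of_forall hl⟩
    obtain ⟨u', D', x', hx', haD, hbD, hxx', -⟩ := h a ha b hb
    rw [uIcc_of_le (hap.trans hpb)] at hxx'
    have hc : ContinuousOn x (Icc a b) :=
      (hx'.continuousOn.mono (hx'.ordConnected.out haD hbD)).congr hxx'.symm
    refine (hc p ⟨hap, hpb⟩).mono_of_mem_nhdsWithin ?_
    filter_upwards [ha', hb'] with s h1 h2 using ⟨h1, h2⟩
  · intro a ha b hb
    obtain ⟨u', D', x', hx', haD, hbD, hxx', huu'⟩ := h a ha b hb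
    refine (hx'.intervalIntegrable a haD b hbD).congr fun s hs => ?_
    simp only [hxx' (uIoc_subset_uIcc hs), huu' (uIoc_subset_uIcc hs)]
  · intro a ha b hb
    obtain ⟨u', D', x', hx', haD, hbD, hxx', huu'⟩ := h a ha b hb
    rw [← hxx' left_mem_uIcc, ← hxx' right_mem_uIcc, hx'.integral_eq a haD b hbD]
    congr 1
    refine intervalIntegral.integral_congr fun s hs => ?_
    simp only [hxx' hs, huu' hs]

/-- Every solution extends to a maximally defined one. -/
lemma IsSolution.exists_isMaximalSolution {f : ℝ → E → F → Γ → E} {u : ℝ → F} {σ : ℝ → Γ}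
    {D : Set ℝ} {x : ℝ → E} (h : IsSolution f u σ D x) :
    ∃ D' x', IsMaximalSolution f u σ D' x' ∧ D ⊆ D' ∧ EqOn x x' D := by
  let X := {p : Set ℝ × (ℝ → E) // IsSolution f u σ p.1 p.2 ∧ D ⊆ p.1 ∧ EqOn x p.2 D}
  let r : X → X → Prop := fun p q => p.1.1 ⊆ q.1.1 ∧ EqOn p.1.2 q.1.2 p.1.1
  have hrefl : ∀ p, r p p := fun p => ⟨Subset.rfl, fun _ _ => rfl⟩
  have hub : ∀ c, IsChain r c → ∃ ub, ∀ p ∈ c, r p ub := by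
    intro c hc
    rcases c.eq_empty_or_nonempty with rfl | ⟨q, hq⟩
    · exact ⟨⟨(D, x), h, Subset.rfl, fun _ _ => rfl⟩, by simp⟩
    have htotal : ∀ p ∈ c, ∀ q ∈ c, r p q ∨ r q p := by
      intro p hp q hq
      by_cases hpq : p = q
      · exact Or.inl (hpq ▸ hrefl p)
      · exact hc hp hq hpq
    classical
    let U : Set ℝ := {s | ∃ p ∈ c, s ∈ p.1.1}
    let y : ℝ → E := fun s => if hs : ∃ p ∈ c, s ∈ p.1.1 then hs.choose.1.2 s else 0
    have hy : ∀ p ∈ c, EqOn p.1.2 y p.1.1 := by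
      intro p hp s hs
      have hs' : ∃ p ∈ c, s ∈ p.1.1 := ⟨p, hp, hs⟩
      simp only [y, dif_pos hs']
      rcases htotal p hp _ hs'.choose_spec.1 with h' | h'
      · exact h'.2 hs
      · exact (h'.2 hs'.choose_spec.2).symm
    have hpair : ∀ a ∈ U, ∀ b ∈ U, ∃ p ∈ c, a ∈ p.1.1 ∧ b ∈ p.1.1 := by
      rintro a ⟨p, hp, ha⟩ b ⟨p', hp', hb⟩
      rcases htotal p hp p' hp' with h' | h'
      · exact ⟨p', hp', h'.1 ha, hb⟩
      · exact ⟨p, hp, ha, h'.1 hb⟩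
    have hqU : q.1.1 ⊆ U := fun s hs => ⟨q, hq, hs⟩
    have hU : IsSolution f u σ U y := by
      refine IsSolution.of_forall_uIcc ⟨fun a ha b hb s hs => ?_⟩ ?_ (q.2.1.nonempty.mono hqU) ?_
      · obtain ⟨p, hp, hap, hbp⟩ := hpair a ha b hb
        exact ⟨p, hp, p.2.1.ordConnected.out hap hbp hs⟩
      · rintro s ⟨p, _, hs⟩
        exact p.2.1.subset_Ici hs
      · intro a ha b hb
        obtain ⟨p, hp, hap, hbp⟩ := hpair a ha b hb
        exact ⟨u, p.1.1, p.1.2, p.2.1, hap, hbp,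
          (hy p hp).mono (p.2.1.ordConnected.uIcc_subset hap hbp), fun _ _ => rfl⟩
    exact ⟨⟨(U, y), hU, q.2.2.1.trans hqU, q.2.2.2.trans ((hy q hq).mono q.2.2.1)⟩,
      fun p hp => ⟨fun s hs => ⟨p, hp, hs⟩, hy p hp⟩⟩
  obtain ⟨⟨⟨D', x'⟩, hsol, hDD', hxx'⟩, hmax⟩ := exists_maximal_of_chains_bounded hub
    (fun {p q w} hpq hqw => ⟨hpq.1.trans hqw.1, hpq.2.trans (hqw.2.mono hpq.1)⟩)
  exact ⟨D', x', ⟨hsol, fun D'' x'' h1 h2 h3 =>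
    (hmax ⟨(D'', x''), h1, hDD'.trans h2, hxx'.trans (h3.mono hDD')⟩ ⟨h2, h3⟩).1⟩, hDD', hxx'⟩

lemma ClassK.measurable_comp_norm [OpensMeasurableSpace F] {χ : ℝ → ℝ} (hχ : ClassK χ)
    {u : ℝ → F} (hu : Measurable u) : Measurable fun s => χ ‖u s‖ := by
  have hc : Continuous fun r : ℝ => χ (max 0 r) :=
    hχ.1.comp_continuous (by fun_prop) fun r => mem_Ici.2 (le_max_left _ _)
  simpa [Function.comp_def] using hc.measurable.comp hu.norm

lemma integral_comp_norm_eq_toReal_lintegral [OpensMeasurableSpace F] {χ : ℝ → ℝ}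
    (hχ : ClassK χ) {u : ℝ → F} (hu : Measurable u) {a b : ℝ} (hab : a ≤ b) :
    ∫ s in a..b, χ ‖u s‖ = (∫⁻ s in Ioc a b, ENNReal.ofReal (χ ‖u s‖)).toReal := by
  rw [intervalIntegral.integral_of_le hab]
  exact integral_eq_lintegral_of_nonneg_ae
    (Eventually.of_forall fun s => hχ.nonneg (norm_nonneg _))
    (hχ.measurable_comp_norm hu).aestronglyMeasurable

lemma integral_comp_norm_nonneg {χ : ℝ → ℝ} (hχ : ClassK χ) (u : ℝ → F) {a b : ℝ}
    (hab : a ≤ b) : 0 ≤ ∫ s in a..b, χ ‖u s‖ :=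
  intervalIntegral.integral_nonneg hab fun _ _ => hχ.nonneg (norm_nonneg _)

lemma integral_comp_norm_le_energy [OpensMeasurableSpace F] {χ : ℝ → ℝ} (hχ : ClassK χ)
    {u : ℝ → F} (hu : Measurable u) (hE : Energy χ u ≠ ⊤) {a b : ℝ} (ha : 0 ≤ a) (hab : a ≤ b) :
    ∫ s in a..b, χ ‖u s‖ ≤ (Energy χ u).toReal := by
  rw [integral_comp_norm_eq_toReal_lintegral hχ hu hab]
  exact ENNReal.toReal_mono hE (lintegral_mono_set fun s hs => ha.trans_lt hs.1)

lemma IsInput.indicator {u : ℝ → F} (hu : IsInput u) {A : Set ℝ} (hA : MeasurableSet A) :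
    IsInput (A.indicator u) := by
  refine ⟨hu.1.indicator hA, fun b => ?_⟩
  obtain ⟨C, hC⟩ := hu.2 b
  exact ⟨C, hC.mono fun s hs hsb => (norm_indicator_le_norm_self u s).trans (hs hsb)⟩

lemma energy_indicator_Icc {χ : ℝ → ℝ} (hχ : ClassK χ) (u : ℝ → F) {a b : ℝ} (ha : 0 ≤ a) :
    Energy χ ((Icc a b).indicator u) = ∫⁻ s in Ioc a b, ENNReal.ofReal (χ ‖u s‖) := by
  have h : (fun s => ENNReal.ofReal (χ ‖(Icc a b).indicator u s‖)) =
      (Icc a b).indicator fun s => ENNReal.ofReal (χ ‖u s‖) := by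
    ext s
    by_cases hs : s ∈ Icc a b <;> simp [hs, hχ.2.2]
  rw [Energy, h, lintegral_indicator measurableSet_Icc, Measure.restrict_restrict measurableSet_Icc]
  refine setLIntegral_congr ?_
  have h' : Ioc a b = Ioc a b ∩ Ioi 0 :=
    (inter_eq_left.2 fun s hs => ha.trans_lt hs.1).symm
  rw [h']
  exact Ioc_ae_eq_Icc.symm.inter (ae_eq_refl _)

lemma energy_indicator_ne_top {χ : ℝ → ℝ} (hχ : ClassK χ) {u : ℝ → F} (hu : IsInput u)
    {a b : ℝ} (ha : 0 ≤ a) : Energy χ ((Icc a b).indicator u) ≠ ⊤ := by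
  obtain ⟨C, hC⟩ := hu.2 b
  rw [energy_indicator_Icc hχ u ha]
  have h : ∫⁻ s in Ioc a b, ENNReal.ofReal (χ ‖u s‖) ≤
      ∫⁻ _ in Ioc a b, ENNReal.ofReal (χ (max C 0)) := by
    refine setLIntegral_mono_ae' measurableSet_Ioc ?_
    filter_upwards [hC] with s hs hsab
    exact ENNReal.ofReal_le_ofReal (hχ.mono (norm_nonneg _)
      (le_max_of_le_left (hs ⟨ha.trans hsab.1.le, hsab.2⟩)))
  refine ne_top_of_le_ne_top ?_ h
  simp [ENNReal.mul_eq_top]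

/-- Causality: on `[t₀, t]` a solution agrees with a maximal solution for the input truncated to
`[t₀, t]`. -/
lemma IsMaximalSolution.exists_truncated {f : ℝ → E → F → Γ → E} {u : ℝ → F} {σ : ℝ → Γ}
    {D : Set ℝ} {x : ℝ → E} (h : IsMaximalSolution f u σ D x) {t₀ t : ℝ} (ht₀ : t₀ ∈ D)
    (ht : t ∈ D) (htt : t₀ ≤ t) :
    ∃ D' x', IsMaximalSolution f ((Icc t₀ t).indicator u) σ D' x' ∧ t₀ ∈ D' ∧ t ∈ D' ∧
      x' t₀ = x t₀ ∧ x' t = x t := by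
  have hsub : Icc t₀ t ⊆ D := h.1.ordConnected.out ht₀ ht
  have hsol : IsSolution f ((Icc t₀ t).indicator u) σ (Icc t₀ t) x :=
    IsSolution.of_forall_uIcc ordConnected_Icc (hsub.trans h.1.subset_Ici)
      ⟨t₀, left_mem_Icc.2 htt⟩ fun a ha b hb => ⟨u, D, x, h.1, hsub ha, hsub hb,
        fun _ _ => rfl, fun s hs =>
          (indicator_of_mem (ordConnected_Icc.uIcc_subset ha hb hs) u).symm⟩
  obtain ⟨D', x', hmax, hDD', hxx'⟩ := hsol.exists_isMaximalSolution
  exact ⟨D', x', hmax, hDD' (left_mem_Icc.2 htt), hDD' (right_mem_Icc.2 htt),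
    (hxx' (left_mem_Icc.2 htt)).symm, (hxx' (right_mem_Icc.2 htt)).symm⟩

/-- Lemma `iiss-charact`: the system is iISS w.r.t. `S` with iISS gain `χ`
iff it is forward complete w.r.t. `S` and, with `‖u‖ = ∫_0^∞ χ(|u(τ)|) dτ`, the uniform
boundedness, uniform stability and uniform attractivity conditions (i)–(iii) hold. -/
theorem stmt3 {n m : ℕ} {Γ : Type*} [Nonempty Γ]
    (f : ℝ → EuclideanSpace ℝ (Fin n) → EuclideanSpace ℝ (Fin m) → Γ → EuclideanSpace ℝ (Fin n))
    (hreg : Regular f)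
    (S : Set (ℝ → Γ)) (hS : ∀ σ ∈ S, IsSwitchingSignal σ)
    (χ : ℝ → ℝ) (hχ : ClassK χ) :
    IISS f S χ ↔
      (ForwardComplete f S ∧
        -- (i) uniform boundedness on finite horizons
        (∀ T, 0 < T → ∀ r, 0 < r → ∀ s, 0 < s → ∃ C, 0 < C ∧
          ∀ t₀, 0 ≤ t₀ → ∀ u, IsInput u → Energy χ u ≤ ENNReal.ofReal s → ∀ σ ∈ S, ∀ D x,
            IsMaximalSolution f u σ D x → t₀ ∈ D → ‖x t₀‖ ≤ r →
              ∀ t ∈ D, t₀ ≤ t → t ≤ t₀ + T → ‖x t‖ ≤ C) ∧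
        -- (ii) uniform stability
        (∀ ε, 0 < ε → ∃ δ, 0 < δ ∧
          ∀ t₀, 0 ≤ t₀ → ∀ u, IsInput u → Energy χ u ≤ ENNReal.ofReal δ → ∀ σ ∈ S, ∀ D x,
            IsMaximalSolution f u σ D x → t₀ ∈ D → ‖x t₀‖ ≤ δ →
              ∀ t ∈ D, t₀ ≤ t → ‖x t‖ ≤ ε) ∧
        -- (iii) uniform attractivity
        (∃ ν, ClassK ν ∧ ∀ r ε : ℝ, 0 < ε → ε ≤ r → ∃ T, 0 < T ∧
          ∀ t₀, 0 ≤ t₀ → ∀ u, IsInput u → Energy χ u ≠ ⊤ → ∀ σ ∈ S, ∀ D x,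
            IsMaximalSolution f u σ D x → t₀ ∈ D → ‖x t₀‖ ≤ r →
              ∀ t ∈ D, t₀ + T ≤ t → ‖x t‖ ≤ ε + ν (Energy χ u).toReal)) := by
  constructor
  · rintro ⟨hfc, β, ρ, hβ, hρ, hest⟩
    have hle : ∀ t₀, 0 ≤ t₀ → ∀ u : ℝ → EuclideanSpace ℝ (Fin m), IsInput u → Energy χ u ≠ ⊤ →
        ∀ σ ∈ S, ∀ D x, IsMaximalSolution f u σ D x → t₀ ∈ D → ∀ r, ‖x t₀‖ ≤ r →
        ∀ T, 0 ≤ T → ∀ t ∈ D, t₀ + T ≤ t → ‖x t‖ ≤ β r T + ρ (Energy χ u).toReal := by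
      intro t₀ ht₀ u hu hE σ hσ D x hx hmem r hr T hT t ht htT
      have htt : t₀ ≤ t := by linarith
      have h1 := hest t₀ ht₀ u hu σ hσ D x hx hmem t ht htt
      have h2 := hρ.mono (integral_comp_norm_nonneg hχ u htt)
        (integral_comp_norm_le_energy hχ hu.1 hE ht₀ htt)
      have h3 : β ‖x t₀‖ (t - t₀) ≤ β r (t - t₀) :=
        (hβ.1 (t - t₀) (by linarith)).1.mono (norm_nonneg _) hr
      have h4 : β r (t - t₀) ≤ β r T :=
        (hβ.2 r ((norm_nonneg _).trans hr)).1 hT (hT.trans (by linarith)) (by linarith)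
      linarith
    refine ⟨hfc, ?_, ?_, ρ, hρ, ?_⟩
    · intro T hT r hr s hs
      have h1 : 0 ≤ β r 0 := (hβ.1 0 le_rfl).1.nonneg hr.le
      have h2 : 0 ≤ ρ s := hρ.nonneg hs.le
      refine ⟨β r 0 + ρ s + 1, by linarith, ?_⟩
      intro t₀ ht₀ u hu hE σ hσ D x hx hmem hxr t ht htt _
      have hE' : Energy χ u ≠ ⊤ := ne_top_of_le_ne_top ENNReal.ofReal_ne_top hE
      have h3 := hle t₀ ht₀ u hu hE' σ hσ D x hx hmem r hxr 0 le_rfl t ht (by linarith)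
      have h4 := hρ.mono ENNReal.toReal_nonneg ((ENNReal.le_ofReal_iff_toReal_le hE' hs.le).1 hE)
      linarith
    · intro ε hε
      have hβ0 := (hβ.1 0 le_rfl).1
      obtain ⟨δ₁, hδ₁, h1⟩ := hβ0.exists_pos_le (half_pos hε)
      obtain ⟨δ₂, hδ₂, h2⟩ := hρ.exists_pos_le (half_pos hε)
      refine ⟨min δ₁ δ₂, lt_min hδ₁ hδ₂, ?_⟩
      intro t₀ ht₀ u hu hE σ hσ D x hx hmem hxr t ht htt
      have hE' : Energy χ u ≠ ⊤ := ne_top_of_le_ne_top ENNReal.ofReal_ne_top hE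
      have h3 := hle t₀ ht₀ u hu hE' σ hσ D x hx hmem δ₁ (hxr.trans (min_le_left _ _)) 0 le_rfl
        t ht (by linarith)
      have h4 := hρ.mono ENNReal.toReal_nonneg
        (((ENNReal.le_ofReal_iff_toReal_le hE' (lt_min hδ₁ hδ₂).le).1 hE).trans (min_le_right _ _))
      linarith
    · intro r ε hε hεr
      obtain ⟨T, hT, hT0⟩ := (((hβ.2 r (hε.le.trans hεr)).2.eventually (gt_mem_nhds hε)).and
        (eventually_gt_atTop 0)).exists
      refine ⟨T, hT0, ?_⟩
      intro t₀ ht₀ u hu hE σ hσ D x hx hmem hxr t ht htt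
      have h3 := hle t₀ ht₀ u hu hE σ hσ D x hx hmem r hxr T hT0.le t ht htt
      linarith
  · rintro ⟨hfc, hbdd, hstab, ν, hν, hattr⟩
    let R : ℝ → ℝ → ℝ → ℝ → Prop := fun a τ e y =>
      ∃ t₀, 0 ≤ t₀ ∧ ∃ u : ℝ → EuclideanSpace ℝ (Fin m), IsInput u ∧ Energy χ u ≠ ⊤ ∧
        ∃ σ ∈ S, ∃ D x, IsMaximalSolution f u σ D x ∧ t₀ ∈ D ∧ ∃ t ∈ D, t₀ ≤ t ∧
          a = ‖x t₀‖ ∧ τ = t - t₀ ∧ e = (Energy χ u).toReal ∧ y = ‖x t‖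
    obtain ⟨β, ρ, hβ, hρ, hest⟩ := exists_classKL_add_classK (R := R) (ν := ν)
      (by
        rintro a τ e y ⟨t₀, -, u, -, -, σ, -, D, x, -, -, t, -, htt, rfl, rfl, rfl, rfl⟩
        exact ⟨norm_nonneg _, sub_nonneg.2 htt, ENNReal.toReal_nonneg⟩)
      (by
        intro T hT r hr s hs
        obtain ⟨C, -, hC⟩ := hbdd T hT r hr s hs
        refine ⟨C, ?_⟩
        rintro a τ e y ⟨t₀, ht₀, u, hu, hE, σ, hσ, D, x, hx, hmem, t, ht, htt, rfl, rfl, rfl, rfl⟩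
          ha he hτ
        exact hC t₀ ht₀ u hu ((ENNReal.le_ofReal_iff_toReal_le hE hs.le).2 he) σ hσ D x hx hmem
          ha t ht htt (by linarith))
      (by
        intro ε hε
        obtain ⟨δ, hδ, h⟩ := hstab ε hε
        refine ⟨δ, hδ, ?_⟩
        rintro a τ e y ⟨t₀, ht₀, u, hu, hE, σ, hσ, D, x, hx, hmem, t, ht, htt, rfl, rfl, rfl, rfl⟩
          ha he
        exact h t₀ ht₀ u hu ((ENNReal.le_ofReal_iff_toReal_le hE hδ.le).2 he) σ hσ D x hx hmem
          ha t ht htt)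
      hν
      (by
        intro r ε hε hεr
        obtain ⟨T, hT, h⟩ := hattr r ε hε hεr
        refine ⟨T, hT, ?_⟩
        rintro a τ e y ⟨t₀, ht₀, u, hu, hE, σ, hσ, D, x, hx, hmem, t, ht, htt, rfl, rfl, rfl, rfl⟩
          ha hτ
        exact h t₀ ht₀ u hu hE σ hσ D x hx hmem ha t ht (by linarith))
    refine ⟨hfc, β, ρ, hβ, hρ, fun t₀ ht₀ u hu σ hσ D x hx hmem t ht htt => ?_⟩
    obtain ⟨D', x', hx', hmem', ht', hx₀, hxt⟩ := hx.exists_truncated hmem ht htt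
    rw [integral_comp_norm_eq_toReal_lintegral hχ hu.1 htt, ← energy_indicator_Icc hχ u ht₀,
      ← hx₀, ← hxt]
    exact hest _ _ _ _ ⟨t₀, ht₀, _, hu.indicator measurableSet_Icc,
      energy_indicator_ne_top hχ hu ht₀, σ, hσ, D', x', hx', hmem', t, ht', htt, rfl, rfl, rfl, rfl⟩
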